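/- arXiv:2312.14653 — 2 statements merged into one kernel-verified Lean document; each statement's English description precedes it below -/
import Mathlib

section
/- For every k ∈ ℂ there exists a unique continuous function f(·,k) : [0,∞) → ℂ satisfying the Volterra integral equation f(x,k) = e^{ikx} − ∫_x^∞ (sin(k(x−t))/k) V(t) f(t,k) dt for all x ≥ 0 (with sin(kz)/k read as z for k = 0). This function satisfies f(x,k) = e^{ikx} for all x ≥ x_I, is continuously differentiable with absolutely continuous first derivative, and solves −f''(x,k) + V(x) f(x,k) = k² f(x,k) for almost every x ≥ 0. -/
open MeasureTheory Set Complex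

/-- The kernel `sin(k z)/k`, read as `z` when `k = 0`. -/
noncomputable def sinck (k z : ℂ) : ℂ := if k = 0 then z else Complex.sin (k * z) / k

section Volterra

open Filter Topology

/-- A continuous function times an integrable function supported in a compact interval is
integrable. -/
lemma integrable_continuousOn_mul_of_support_subset_Icc {a b : ℝ} {φ w : ℝ → ℂ}
    (hφ : ContinuousOn φ (Icc a b)) (hw : Integrable w) (hs : Function.support w ⊆ Icc a b) :
    Integrable (fun t => φ t * w t) := by
  have h := (hw.integrableOn (s := Icc a b)).continuousOn_mul hφ isCompact_Icc
  refine (integrableOn_iff_integrable_of_support_subset ?_).1 h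
  exact (Function.support_mul_subset_right φ w).trans hs

/-- Differentiation of a Volterra-type integral whose kernel vanishes on the diagonal: the moving
endpoint does not contribute, even where the density is not continuous. -/
lemma hasDerivAt_integral_Ioi_kernel {X : ℝ} {N N' w : ℝ → ℂ}
    (hN : ∀ z, HasDerivAt N (N' z) z) (hN' : Continuous N') (hN0 : N 0 = 0)
    (hw : Integrable w) (hs : Function.support w ⊆ Icc 0 X) (x : ℝ) :
    HasDerivAt (fun y => ∫ t in Ioi y, N (y - t) * w t) (∫ t in Ioi x, N' (x - t) * w t) x := by
  have hNc : Continuous N := continuous_iff_continuousAt.2 fun z => (hN z).continuousAt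
  have hG : ∀ y, ∫ t in Ioi y, N (y - t) * w t = ∫ t, N (min (y - t) 0) * w t := by
    intro y
    rw [← integral_indicator measurableSet_Ioi]
    congr 1
    ext t
    by_cases h : y < t
    · rw [indicator_of_mem (mem_Ioi.2 h), min_eq_left (by linarith)]
    · rw [indicator_of_notMem (by simpa using h), min_eq_right (by linarith), hN0, zero_mul]
  have hG' : ∫ t in Ioi x, N' (x - t) * w t
      = ∫ t, (Ioi x).indicator (fun t => N' (x - t) * w t) t :=
    (integral_indicator measurableSet_Ioi).symm
  simp_rw [hG]
  rw [hG']
  set R : ℝ := |x| + |X| + 1 with hR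
  obtain ⟨C, hC⟩ := (isCompact_Icc (a := -R) (b := R)).exists_bound_of_continuousOn
    hN'.continuousOn
  have hC0 : 0 ≤ C := (norm_nonneg _).trans
    (hC 0 (by constructor <;> linarith [abs_nonneg x, abs_nonneg X]))
  have hint : ∀ φ : ℝ → ℂ, Continuous φ → Integrable (fun t => φ t * w t) := fun φ hφ =>
    integrable_continuousOn_mul_of_support_subset_Icc hφ.continuousOn hw hs
  refine (hasDerivAt_integral_of_dominated_loc_of_lip (bound := fun t => C * ‖w t‖)
    (Metric.ball_mem_nhds x one_pos) ?_ ?_ ?_ ?_ ?_ ?_).2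
  · exact Eventually.of_forall fun y => (hint _ (by fun_prop)).aestronglyMeasurable
  · exact hint _ (by fun_prop)
  · exact ((hint _ (by fun_prop)).indicator measurableSet_Ioi).aestronglyMeasurable
  · refine Eventually.of_forall fun t => ?_
    by_cases ht : t ∈ Icc 0 X
    · refine LipschitzOnWith.of_dist_le_mul fun y hy z hz => ?_
      have hmem : ∀ y ∈ Metric.ball x 1, min (y - t) 0 ∈ Icc (-R) R := by
        intro y hy
        rw [Metric.mem_ball, Real.dist_eq] at hy
        have h1 := abs_lt.1 hy
        have h2 := neg_abs_le x
        have h3 := le_abs_self x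
        have h4 := le_abs_self X
        have h5 := ht.1
        have h6 := ht.2
        constructor
        · exact le_min (by linarith) (by linarith [abs_nonneg x])
        · exact (min_le_right _ _).trans (by linarith [abs_nonneg x])
      have hmv := (convex_Icc (-R) R).norm_image_sub_le_of_norm_hasDerivWithin_le
        (fun u _ => (hN u).hasDerivWithinAt) hC (hmem z hz) (hmem y hy)
      have hmin : ‖min (y - t) 0 - min (z - t) 0‖ ≤ dist y z := by
        have := abs_min_sub_min_le_max (y - t) 0 (z - t) 0
        simpa [Real.dist_eq] using this
      rw [dist_eq_norm, ← sub_mul, norm_mul, Real.coe_nnabs,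
        abs_of_nonneg (mul_nonneg hC0 (norm_nonneg _))]
      calc _ ≤ C * dist y z * ‖w t‖ := by
            gcongr
            exact hmv.trans (by gcongr)
        _ = _ := by ring
    · have : w t = 0 := Function.notMem_support.1 fun h => ht (hs h)
      simp only [this, mul_zero]
      exact LipschitzOnWith.of_dist_le_mul fun y _ z _ => by simp
  · exact hw.norm.const_mul C
  · filter_upwards [compl_mem_ae_iff.2 (measure_singleton x)] with t ht
    rcases lt_or_gt_of_ne (show t ≠ x from ht) with h | h
    · rw [indicator_of_notMem (by simpa using h.le)]
      refine (hasDerivAt_const x (0 : ℂ)).congr_of_eventuallyEq ?_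
      filter_upwards [lt_mem_nhds h] with y hy
      rw [min_eq_right (by linarith), hN0, zero_mul]
    · rw [indicator_of_mem (mem_Ioi.2 h)]
      refine (((hN (x - t)).comp_sub_const x t).mul_const (w t)).congr_of_eventuallyEq ?_
      filter_upwards [gt_mem_nhds h] with y hy
      rw [min_eq_left (by linarith)]

/-- An integrable function has small integral above a high enough level. -/
lemma exists_integral_max_norm_sub_le {w : ℝ → ℂ} (hw : Integrable w) {ε : ℝ} (hε : 0 < ε) :
    ∃ B : ℝ, 0 ≤ B ∧ ∫ t, max (‖w t‖ - B) 0 ≤ ε := by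
  have h : Tendsto (fun n : ℕ => ∫ t, max (‖w t‖ - n) 0) atTop (𝓝 (∫ _ : ℝ, (0 : ℝ))) := by
    refine tendsto_integral_of_dominated_convergence (fun t => ‖w t‖) ?_ hw.norm ?_ ?_
    · exact fun n => (hw.norm.aestronglyMeasurable.sub aestronglyMeasurable_const).sup
        aestronglyMeasurable_const
    · refine fun n => Eventually.of_forall fun t => ?_
      rw [Real.norm_of_nonneg (le_max_right _ _)]
      exact max_le (by linarith [n.cast_nonneg (α := ℝ)]) (norm_nonneg _)
    · refine Eventually.of_forall fun t => ?_
      obtain ⟨m, hm⟩ := exists_nat_ge ‖w t‖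
      refine tendsto_const_nhds.congr' ?_
      filter_upwards [eventually_ge_atTop m] with n hn
      have : (m : ℝ) ≤ n := by exact_mod_cast hn
      rw [max_eq_right (by linarith)]
  rw [integral_zero] at h
  obtain ⟨n, hn⟩ := (h.eventually (ge_mem_nhds hε)).exists
  exact ⟨n, n.cast_nonneg, hn⟩

/-- A Volterra kernel becomes small in the operator norm after exponential weighting. -/
lemma exists_exp_weight_integral_le {X : ℝ} {N w : ℝ → ℂ} (hN : Continuous N)
    (hw : Integrable w) (hs : Function.support w ⊆ Icc 0 X) :
    ∃ l : ℝ, ∀ x ∈ Icc 0 X,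
      ∫ t in Ioi x, ‖(Real.exp (l * (x - t)) : ℂ) * N (x - t)‖ * ‖w t‖ ≤ 1 / 2 := by
  obtain ⟨C, hC⟩ := (isCompact_Icc (a := -X) (b := X)).exists_bound_of_continuousOn
    hN.continuousOn
  set M := |C| + 1
  have hM : 0 < M := by positivity
  obtain ⟨B, hB0, hB⟩ := exists_integral_max_norm_sub_le hw (ε := 1 / (4 * M)) (by positivity)
  set l : ℝ := 4 * M * B + 1 with hl
  have hl0 : 0 < l := by positivity
  refine ⟨l, fun x hx => ?_⟩
  have hexp : IntegrableOn (fun t => Real.exp (-l * t)) (Ioi x) :=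
    integrableOn_exp_mul_Ioi (by linarith) x
  have htr : Integrable (fun t => max (‖w t‖ - B) 0) := by
    refine hw.norm.mono' ((hw.norm.aestronglyMeasurable.sub aestronglyMeasurable_const).sup
        aestronglyMeasurable_const) (Eventually.of_forall fun t => ?_)
    rw [Real.norm_of_nonneg (le_max_right _ _)]
    exact max_le (by linarith) (norm_nonneg _)
  have hi1 := hexp.const_mul (M * B * Real.exp (l * x))
  have hi2 := (htr.const_mul M).integrableOn (s := Ioi x)
  calc ∫ t in Ioi x, ‖(Real.exp (l * (x - t)) : ℂ) * N (x - t)‖ * ‖w t‖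
      ≤ ∫ t in Ioi x, (M * B * Real.exp (l * x) * Real.exp (-l * t)
          + M * max (‖w t‖ - B) 0) := by
        refine integral_mono_of_nonneg (Eventually.of_forall fun t => by positivity)
          (hi1.add hi2) ?_
        filter_upwards [ae_restrict_mem measurableSet_Ioi] with t ht
        have ht' : x < t := ht
        by_cases hw0 : t ∈ Icc 0 X
        · have hNb : ‖N (x - t)‖ ≤ M :=
            (hC _ ⟨by linarith [hx.1, hw0.2], by linarith [hx.2, hw0.1]⟩).trans
              (by linarith [le_abs_self C])
          have he : Real.exp (l * (x - t)) ≤ 1 := Real.exp_le_one_iff.2 (by nlinarith)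
          have hsplit : Real.exp (l * x) * Real.exp (-l * t) = Real.exp (l * (x - t)) := by
            rw [← Real.exp_add]; ring_nf
          have hwb : ‖w t‖ ≤ B + max (‖w t‖ - B) 0 := by linarith [le_max_left (‖w t‖ - B) 0]
          rw [norm_mul, Complex.norm_real, Real.norm_of_nonneg (Real.exp_pos _).le,
            mul_assoc (M * B), hsplit]
          calc _ ≤ Real.exp (l * (x - t)) * M * (B + max (‖w t‖ - B) 0) := by gcongr
            _ = M * B * Real.exp (l * (x - t))
                + Real.exp (l * (x - t)) * (M * max (‖w t‖ - B) 0) := by ring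
            _ ≤ _ := by
                exact add_le_add_right (mul_le_of_le_one_left (by positivity) he) _
        · have : w t = 0 := Function.notMem_support.1 fun h => hw0 (hs h)
          rw [this, norm_zero, mul_zero]
          positivity
    _ = M * B / l + M * ∫ t in Ioi x, max (‖w t‖ - B) 0 := by
        rw [integral_add hi1 hi2, integral_const_mul, integral_const_mul,
          integral_exp_mul_Ioi (by linarith), neg_div_neg_eq, mul_div_assoc', mul_assoc (M * B),
          ← Real.exp_add]
        simp
    _ ≤ 1 / 4 + M * (1 / (4 * M)) := by
        refine add_le_add ?_ (mul_le_mul_of_nonneg_left ?_ hM.le)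
        · rw [div_le_iff₀ hl0]; linarith
        · exact (setIntegral_le_integral htr
            (Eventually.of_forall fun t => le_max_right _ _)).trans hB
    _ = 1 / 2 := by field_simp; norm_num

/-- The Volterra equation with a small kernel has exactly one continuous solution on `[0, X]`. -/
lemma exists_unique_volterra_of_small {X : ℝ} (hX : 0 ≤ X) {N N' w E : ℝ → ℂ}
    (hN : ∀ z, HasDerivAt N (N' z) z) (hN' : Continuous N') (hN0 : N 0 = 0)
    (hw : Integrable w) (hs : Function.support w ⊆ Icc 0 X) (hE : Continuous E)
    (hsmall : ∀ x ∈ Icc 0 X, ∫ t in Ioi x, ‖N (x - t)‖ * ‖w t‖ ≤ 1 / 2) :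
    ∃ g : C(Icc 0 X, ℂ), ∀ h : C(Icc 0 X, ℂ),
      (∀ x : Icc 0 X, h x = E x - ∫ t in Ioi (x : ℝ), N (x - t) * (w t * IccExtend hX h t)) ↔
        h = g := by
  have hNc : Continuous N := continuous_iff_continuousAt.2 fun z => (hN z).continuousAt
  have hprod : ∀ h : C(Icc 0 X, ℂ), Integrable (fun t => w t * IccExtend hX h t) := fun h => by
    simpa only [mul_comm] using integrable_continuousOn_mul_of_support_subset_Icc
      (φ := IccExtend hX h) h.continuous.Icc_extend'.continuousOn hw hs
  have hsp : ∀ h : C(Icc 0 X, ℂ),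
      Function.support (fun t => w t * IccExtend hX h t) ⊆ Icc 0 X := fun h =>
    (Function.support_mul_subset_left w _).trans hs
  let T : C(Icc 0 X, ℂ) → C(Icc 0 X, ℂ) := fun h =>
    ⟨fun x => E x - ∫ t in Ioi (x : ℝ), N (x - t) * (w t * IccExtend hX h t), by
      have hc : Continuous fun x : ℝ => ∫ t in Ioi x, N (x - t) * (w t * IccExtend hX h t) :=
        continuous_iff_continuousAt.2 fun x =>
          (hasDerivAt_integral_Ioi_kernel hN hN' hN0 (hprod h) (hsp h) x).continuousAt
      exact (hE.comp continuous_subtype_val).sub (hc.comp continuous_subtype_val)⟩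
  have hT : ContractingWith (1 / 2) T := by
    refine ⟨by norm_num, LipschitzWith.of_dist_le_mul fun g h => ?_⟩
    rw [ContinuousMap.dist_le (by positivity)]
    intro x
    have hi : ∀ h : C(Icc 0 X, ℂ), IntegrableOn
        (fun t => N (x - t) * (w t * IccExtend hX h t)) (Ioi (x : ℝ)) := fun h =>
      (integrable_continuousOn_mul_of_support_subset_Icc (by fun_prop) (hprod h)
        (hsp h)).integrableOn
    have hin : IntegrableOn (fun t => ‖N (x - t)‖ * ‖w t‖) (Ioi (x : ℝ)) := by
      have := (integrable_continuousOn_mul_of_support_subset_Icc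
        (φ := fun t => N (x - t)) (by fun_prop) hw hs).norm
      simpa only [norm_mul] using this.integrableOn
    have hd : T g x - T h x = ∫ t in Ioi (x : ℝ), (N (x - t) * (w t * IccExtend hX h t)
        - N (x - t) * (w t * IccExtend hX g t)) := by
      rw [integral_sub (hi h) (hi g)]
      simp only [T, ContinuousMap.coe_mk]
      ring
    rw [dist_eq_norm, hd]
    calc _ ≤ ∫ t in Ioi (x : ℝ), ‖N (x - t)‖ * ‖w t‖ * dist g h := by
          refine norm_integral_le_of_norm_le (hin.mul_const _) (Eventually.of_forall fun t => ?_)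
          rw [← mul_sub, ← mul_sub, norm_mul, norm_mul, ← mul_assoc]
          gcongr
          rw [← dist_eq_norm, dist_comm]
          exact ContinuousMap.dist_apply_le_dist _
      _ = (∫ t in Ioi (x : ℝ), ‖N (x - t)‖ * ‖w t‖) * dist g h := integral_mul_const _ _
      _ ≤ _ := by
          gcongr
          simpa using hsmall x x.2
  refine ⟨hT.fixedPoint T, fun h => ⟨fun hh => hT.fixedPoint_unique ?_, ?_⟩⟩
  · exact ContinuousMap.ext fun x => (hh x).symm
  · rintro rfl x
    exact (DFunLike.congr_fun hT.fixedPoint_isFixedPt x).symm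

/-- Existence and uniqueness for a Volterra equation whose kernel vanishes on the diagonal. -/
lemma exists_unique_volterra {X : ℝ} (hX : 0 ≤ X) {N N' w E : ℝ → ℂ}
    (hN : ∀ z, HasDerivAt N (N' z) z) (hN' : Continuous N') (hN0 : N 0 = 0)
    (hw : Integrable w) (hs : Function.support w ⊆ Icc 0 X) (hE : Continuous E) :
    ∃ f : ℝ → ℂ, Continuous f ∧ (∀ x, f x = E x - ∫ t in Ioi x, N (x - t) * (w t * f t)) ∧
      ∀ g : ℝ → ℂ, ContinuousOn g (Ici 0) →
        (∀ x, 0 ≤ x → g x = E x - ∫ t in Ioi x, N (x - t) * (w t * g t)) →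
        EqOn g f (Ici 0) := by
  have hNc : Continuous N := continuous_iff_continuousAt.2 fun z => (hN z).continuousAt
  obtain ⟨l, hl⟩ := exists_exp_weight_integral_le hNc hw hs
  let e : ℝ → ℂ := fun x => (Real.exp (l * x) : ℂ)
  have he : Continuous e := by fun_prop
  have hadd : ∀ x y, e (x + y) = e x * e y := fun x y => by
    simp only [e, mul_add, Real.exp_add, ofReal_mul]
  have he1 : ∀ x, e (-x) * e x = 1 := fun x => by
    rw [← hadd]; simp [e]
  have hed : ∀ z, HasDerivAt e (e z * l) z := fun z => by
    have := ((hasDerivAt_id z).const_mul l).exp.ofReal_comp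
    simpa [e] using this
  obtain ⟨g₀, hg₀⟩ := exists_unique_volterra_of_small hX (N := fun z => e z * N z)
    (E := fun x => e x * E x) (fun z => (hed z).mul (hN z)) (by fun_prop) (by simp [hN0]) hw hs
    (by fun_prop) hl
  have hext : ∀ (φ : ℝ → ℂ) (h : Icc 0 X → ℂ), (∀ x : Icc 0 X, h x = φ x) →
      ∀ t, w t * IccExtend hX h t = w t * φ t := by
    intro φ h hh t
    by_cases ht : t ∈ Icc 0 X
    · rw [IccExtend_of_mem _ _ ht, hh]
    · rw [Function.notMem_support.1 fun h => ht (hs h), zero_mul, zero_mul]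
  have hweight : ∀ (φ : ℝ → ℂ) (x : ℝ),
      ∫ t in Ioi x, e (x - t) * N (x - t) * (w t * (e t * φ t))
        = e x * ∫ t in Ioi x, N (x - t) * (w t * φ t) := by
    intro φ x
    rw [← integral_const_mul]
    congr 1
    ext t
    have : e x = e (x - t) * e t := by rw [← hadd, sub_add_cancel]
    rw [this]; ring
  have hg₀' := (hg₀ g₀).2 rfl
  let G : ℝ → ℂ := fun t => e (-t) * IccExtend hX g₀ t
  have hGc : Continuous G :=
    (he.comp continuous_neg).mul g₀.continuous.Icc_extend'
  have heG : ∀ t, IccExtend hX g₀ t = e t * G t := fun t => by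
    simp only [G]
    rw [← mul_assoc, mul_comm (e t), he1, one_mul]
  let f : ℝ → ℂ := fun x => E x - ∫ t in Ioi x, N (x - t) * (w t * G t)
  have hfG : ∀ x ∈ Icc 0 X, f x = G x := by
    intro x hx
    have h := hg₀' ⟨x, hx⟩
    simp only [heG] at h
    rw [hweight, ← mul_sub] at h
    simp only [G, IccExtend_of_mem hX g₀ hx, h, f]
    rw [← mul_assoc, he1, one_mul]
  have hwf : ∀ t, w t * f t = w t * G t := by
    intro t
    by_cases ht : t ∈ Icc 0 X
    · rw [hfG t ht]
    · rw [Function.notMem_support.1 fun h => ht (hs h), zero_mul, zero_mul]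
  refine ⟨f, ?_, fun x => by simp only [hwf]; rfl, ?_⟩
  · have hwG : Integrable (fun t => w t * G t) := by
      simpa only [mul_comm] using integrable_continuousOn_mul_of_support_subset_Icc
        hGc.continuousOn hw hs
    exact hE.sub (continuous_iff_continuousAt.2 fun x =>
      (hasDerivAt_integral_Ioi_kernel hN hN' hN0 hwG
        ((Function.support_mul_subset_left w _).trans hs) x).continuousAt)
  · intro g hgc hg
    let h : C(Icc 0 X, ℂ) := ⟨fun x => e x * g x,
      (he.comp continuous_subtype_val).mul
        ((hgc.mono Icc_subset_Ici_self).domRestrict)⟩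
    have hh : h = g₀ := by
      refine (hg₀ h).1 fun x => ?_
      simp only [hext (fun t => e t * g t) h (fun _ => rfl)]
      rw [hweight, ← mul_sub, ← hg x x.2.1]
      rfl
    have hgG : ∀ t, w t * g t = w t * G t := by
      intro t
      by_cases ht : t ∈ Icc 0 X
      · simp only [G, ← hh]
        rw [IccExtend_of_mem hX h ht]
        change _ = w t * (e (-t) * (e t * g t))
        rw [← mul_assoc (e (-t)), he1, one_mul]
      · rw [Function.notMem_support.1 fun h => ht (hs h), zero_mul, zero_mul]
    intro x hx
    rw [hg x hx]
    simp only [hgG]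
    rfl

end Volterra

lemma hasDerivAt_sinck (k : ℂ) (z : ℝ) :
    HasDerivAt (fun z : ℝ => sinck k z) (Complex.cos (k * z)) z := by
  unfold sinck
  split_ifs with hk
  · simpa [hk] using (hasDerivAt_id z).ofReal_comp
  · have h := ((Complex.hasDerivAt_sin (k * z)).comp z
      ((hasDerivAt_id z).ofReal_comp.const_mul k)).div_const k
    simpa [hk, Function.comp_def] using h

lemma hasDerivAt_cos_mul_sub_one (k : ℂ) (z : ℝ) :
    HasDerivAt (fun z : ℝ => Complex.cos (k * z) - 1) (-k ^ 2 * sinck k z) z := by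
  have h := ((Complex.hasDerivAt_cos (k * z)).comp z
    ((hasDerivAt_id z).ofReal_comp.const_mul k)).sub_const 1
  refine h.congr_deriv ?_
  unfold sinck
  split_ifs with hk
  · simp [hk]
  · field_simp
    simp

lemma continuous_sinck (k : ℂ) : Continuous (fun z : ℝ => sinck k z) :=
  continuous_iff_continuousAt.2 fun z => (hasDerivAt_sinck k z).continuousAt

/-- Existence and uniqueness of the Jost solution as a continuous solution of the
Volterra integral equation, together with its basic properties. -/
theorem jost_volterra_existence_uniqueness
    (xI : ℝ) (hxI : 0 < xI) (V : ℝ → ℝ)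
    (hV : IntegrableOn V (Set.Ioi 0))
    (hsupp : Function.support V ⊆ Set.Icc 0 xI) (k : ℂ) :
    ∃ f : ℝ → ℂ,
      (ContinuousOn f (Set.Ici 0) ∧
        ∀ x : ℝ, 0 ≤ x →
          f x = Complex.exp (Complex.I * k * x)
            - ∫ t in Set.Ioi x, sinck k ((x : ℂ) - (t : ℂ)) * (V t : ℂ) * f t) ∧
      (∀ g : ℝ → ℂ,
        (ContinuousOn g (Set.Ici 0) ∧
          ∀ x : ℝ, 0 ≤ x →
            g x = Complex.exp (Complex.I * k * x)
              - ∫ t in Set.Ioi x, sinck k ((x : ℂ) - (t : ℂ)) * (V t : ℂ) * g t) →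
        Set.EqOn g f (Set.Ici 0)) ∧
      (∀ x : ℝ, xI ≤ x → f x = Complex.exp (Complex.I * k * x)) ∧
      (∃ f' f'' : ℝ → ℂ,
        (∀ x ∈ Set.Ici (0 : ℝ), HasDerivWithinAt f (f' x) (Set.Ici 0) x) ∧
        ContinuousOn f' (Set.Ici 0) ∧
        (∀ x : ℝ, 0 ≤ x → f' x = f' 0 + ∫ t in Set.Ioc 0 x, f'' t) ∧
        (∀ᵐ x ∂(volume.restrict (Set.Ici (0 : ℝ))),
          -f'' x + (V x : ℂ) * f x = k ^ 2 * f x)) := by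
  have hW : Integrable (fun t => (V t : ℂ)) := by
    refine Integrable.ofReal ?_
    have h : IntegrableOn V (Ici 0) := (integrableOn_Ici_iff_integrableOn_Ioi).2 hV
    exact (integrableOn_iff_integrable_of_support_subset
      (hsupp.trans Icc_subset_Ici_self)).1 h
  have hWs : Function.support (fun t => (V t : ℂ)) ⊆ Icc 0 xI := fun t ht =>
    hsupp fun h => ht (by simp [h])
  let E : ℝ → ℂ := fun x => Complex.exp (Complex.I * k * x)
  have hE : ∀ x, HasDerivAt E (Complex.I * k * E x) x := fun x => by
    have h := ((hasDerivAt_id x).ofReal_comp.const_mul (Complex.I * k)).cexp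
    simpa [E, mul_comm] using h
  have hEc : Continuous E := by fun_prop
  obtain ⟨f, hfc, hf, huniq⟩ := exists_unique_volterra hxI.le (hasDerivAt_sinck k)
    (by fun_prop) (by simp [sinck]) hW hWs hEc
  let w : ℝ → ℂ := fun t => (V t : ℂ) * f t
  have hw : Integrable w := by
    simpa only [w, mul_comm] using integrable_continuousOn_mul_of_support_subset_Icc
      hfc.continuousOn hW hWs
  have hws : Function.support w ⊆ Icc 0 xI := (Function.support_mul_subset_left _ _).trans hWs
  have hcos : Continuous fun z : ℝ => Complex.cos (k * z) := by fun_prop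
  have hS : ∀ x, HasDerivAt (fun y => ∫ t in Ioi y, sinck k ((y - t : ℝ) : ℂ) * w t)
      (∫ t in Ioi x, Complex.cos (k * ((x - t : ℝ) : ℂ)) * w t) x := fun x =>
    hasDerivAt_integral_Ioi_kernel (hasDerivAt_sinck k) hcos (by simp [sinck]) hw hws x
  have hH : ∀ x, HasDerivAt
      (fun y => ∫ t in Ioi y, (Complex.cos (k * ((y - t : ℝ) : ℂ)) - 1) * w t)
      (∫ t in Ioi x, (-k ^ 2 * sinck k ((x - t : ℝ) : ℂ)) * w t) x := fun x =>
    hasDerivAt_integral_Ioi_kernel (hasDerivAt_cos_mul_sub_one k)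
      (continuous_const.mul (continuous_sinck k)) (by simp) hw hws x
  let f' : ℝ → ℂ := fun x => Complex.I * k * E x
    - ∫ t in Ioi x, Complex.cos (k * ((x - t : ℝ) : ℂ)) * w t
  let f'' : ℝ → ℂ := fun x => w x - k ^ 2 * f x
  let P : ℝ → ℂ := fun x => Complex.I * k * E x
    - ∫ t in Ioi x, (Complex.cos (k * ((x - t : ℝ) : ℂ)) - 1) * w t
  have hf' : ∀ x, HasDerivAt f (f' x) x := fun x =>
    ((hE x).sub (hS x)).congr_of_eventuallyEq (Filter.Eventually.of_forall hf)
  have hP : ∀ x, HasDerivAt P (-k ^ 2 * f x) x := fun x => by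
    refine (((hE x).const_mul (Complex.I * k)).sub (hH x)).congr_deriv ?_
    simp only [mul_assoc]
    rw [integral_const_mul, hf x]
    simp only [w]
    linear_combination (k ^ 2 * E x) * Complex.I_sq
  have hf'P : ∀ x, f' x = P x - ∫ t in Ioi x, w t := fun x => by
    have hi : Integrable fun t => (Complex.cos (k * ((x - t : ℝ) : ℂ)) - 1) * w t :=
      integrable_continuousOn_mul_of_support_subset_Icc (by fun_prop) hw hws
    simp only [P]
    rw [sub_sub, ← integral_add hi.integrableOn hw.integrableOn]
    simp only [f', sub_mul, one_mul, sub_add_cancel]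
  have hf''i : ∀ a b, IntervalIntegrable f'' volume a b := fun a b =>
    hw.intervalIntegrable.sub ((continuous_const.mul hfc).intervalIntegrable a b)
  have hFTC : ∀ x, f' x = f' 0 + ∫ t in (0 : ℝ)..x, f'' t := fun x => by
    have h1 := intervalIntegral.integral_eq_sub_of_hasDerivAt (fun y _ => hP y)
      ((continuous_const.mul hfc).intervalIntegrable 0 x)
    have h2 := intervalIntegral.integral_Ioi_sub_Ioi' (hw.integrableOn (s := Ioi 0))
      (hw.integrableOn (s := Ioi x))
    have h3 : ∫ t in (0 : ℝ)..x, f'' t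
        = (∫ t in (0 : ℝ)..x, w t) + ∫ t in (0 : ℝ)..x, -k ^ 2 * f t := by
      rw [← intervalIntegral.integral_add hw.intervalIntegrable
        (Continuous.intervalIntegrable (by fun_prop) 0 x)]
      simp only [f'', neg_mul, sub_eq_add_neg]
    rw [hf'P, hf'P, h3, h1, ← h2]
    ring
  have hf'c : Continuous f' :=
    (continuous_const.add (intervalIntegral.continuous_primitive hf''i 0)).congr
      fun x => (hFTC x).symm
  refine ⟨f, ⟨hfc.continuousOn, fun x _ => ?_⟩, ?_, ?_, f', f'',
    fun x _ => (hf' x).hasDerivWithinAt, hf'c.continuousOn, ?_, ?_⟩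
  · simpa only [E, mul_assoc, ofReal_sub] using hf x
  · rintro g ⟨hgc, hg⟩
    exact huniq g hgc fun x hx => by
      simpa only [E, mul_assoc, ofReal_sub] using hg x hx
  · intro x hx
    rw [hf x, setIntegral_eq_zero_of_forall_eq_zero, sub_zero]
    intro t ht
    have : V t = 0 := Function.notMem_support.1 fun h =>
      absurd (hsupp h).2 (not_le.2 (hx.trans_lt ht))
    simp [this]
  · intro x hx
    rw [← intervalIntegral.integral_of_le hx]
    exact hFTC x
  · refine Filter.Eventually.of_forall fun x => ?_
    simp only [f'', w]
    ring
end

section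
/- Uniqueness (Borg–Marchenko type): let V and Ṽ both satisfy V, V', Ṽ, Ṽ' ∈ L¹(0,∞) with supports contained in [0,x_I], let f, f_h and f̃, f̃_h be their Jost solutions and Jost functions with the same boundary constant h, and let M, M̃ be the associated Weyl functions. If f(0,k)/f_h(k) = f̃(0,k)/f̃_h(k) for every k with Im k > 0 and f_h(k)·f̃_h(k) ≠ 0, then V = Ṽ almost everywhere on [0,∞). -/
open MeasureTheory Set Complex

/-- `f`, with spatial derivative `f'`, is the Jost solution with parameter `k`
for the potential `W`. -/
def IsJostSolution (W : ℝ → ℝ) (xI : ℝ) (k : ℂ) (f f' : ℝ → ℂ) : Prop :=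
  (∀ x ∈ Set.Ici (0 : ℝ), HasDerivWithinAt f (f' x) (Set.Ici 0) x) ∧
  (∀ x ∈ Set.Ici (0 : ℝ),
    HasDerivWithinAt f' ((W x : ℂ) * f x - k ^ 2 * f x) (Set.Ici 0) x) ∧
  (∀ x : ℝ, xI ≤ x → f x = Complex.exp (Complex.I * k * x))

/-- The Jost function `f_h(k) = h f(0,k) + f'(0,k)`. -/
noncomputable def jostFn (h : ℝ) (f f' : ℂ → ℝ → ℂ) (k : ℂ) : ℂ :=
  (h : ℂ) * f k 0 + f' k 0

open Filter Topology

/-- `u`, with derivative `u'`, solves `-u'' + Q u = k² u` on `[0, L]`. -/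
def IsSolutionOn (Q : ℝ → ℝ) (L : ℝ) (k : ℂ) (u u' : ℝ → ℂ) : Prop :=
  ∀ x ∈ Icc 0 L, HasDerivWithinAt u (u' x) (Icc 0 L) x ∧
    HasDerivWithinAt u' ((Q x : ℂ) * u x - k ^ 2 * u x) (Icc 0 L) x

theorem norm_cos_le_exp_im {z : ℂ} (hz : 0 ≤ z.im) : ‖Complex.cos z‖ ≤ Real.exp z.im := by
  have h1 : ‖cexp (z * I)‖ ≤ Real.exp z.im := by
    rw [norm_exp]; simp; linarith
  have h2 : ‖cexp (-z * I)‖ ≤ Real.exp z.im := by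
    rw [norm_exp]; simp
  rw [Complex.cos, norm_div, Complex.norm_ofNat]
  linarith [norm_add_le (cexp (z * I)) (cexp (-z * I))]

theorem norm_sin_le_exp_im {z : ℂ} (hz : 0 ≤ z.im) : ‖Complex.sin z‖ ≤ Real.exp z.im := by
  have h1 : ‖cexp (z * I)‖ ≤ Real.exp z.im := by
    rw [norm_exp]; simp; linarith
  have h2 : ‖cexp (-z * I)‖ ≤ Real.exp z.im := by
    rw [norm_exp]; simp
  rw [Complex.sin, norm_div, Complex.norm_ofNat, norm_mul, norm_I, mul_one]
  linarith [norm_sub_le (cexp (-z * I)) (cexp (z * I))]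

namespace IsSolutionOn

variable {Q : ℝ → ℝ} {L B : ℝ} {k : ℂ} {u u' v v' : ℝ → ℂ}

theorem continuousOn (hu : IsSolutionOn Q L k u u') : ContinuousOn u (Icc 0 L) :=
  fun x hx => (hu x hx).1.continuousWithinAt

theorem continuousOn_deriv (hu : IsSolutionOn Q L k u u') : ContinuousOn u' (Icc 0 L) :=
  fun x hx => (hu x hx).2.continuousWithinAt

theorem linear_comb (hu : IsSolutionOn Q L k u u') (hv : IsSolutionOn Q L k v v') (a b : ℂ) :
    IsSolutionOn Q L k (fun x => a * u x + b * v x) (fun x => a * u' x + b * v' x) := by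
  intro x hx
  refine ⟨((hu x hx).1.const_mul a).fun_add ((hv x hx).1.const_mul b), ?_⟩
  exact (((hu x hx).2.const_mul a).fun_add ((hv x hx).2.const_mul b)).congr_deriv (by ring)

theorem neg_param (hu : IsSolutionOn Q L (-k) u u') : IsSolutionOn Q L k u u' := by
  simpa [IsSolutionOn] using hu

theorem reflect (hu : IsSolutionOn Q L k u u') :
    IsSolutionOn (fun x => Q (L - x)) L k (fun x => u (L - x)) (fun x => -u' (L - x)) := by
  intro x hx
  have hx' : L - x ∈ Icc 0 L := ⟨by linarith [hx.2], by linarith [hx.1]⟩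
  have hm : MapsTo (fun y : ℝ => L - y) (Icc 0 L) (Icc 0 L) :=
    fun y hy => ⟨by linarith [hy.2], by linarith [hy.1]⟩
  have hd : HasDerivWithinAt (fun y : ℝ => L - y) (-1) (Icc 0 L) x := by
    simpa using (hasDerivWithinAt_id x (Icc 0 L)).const_sub L
  constructor
  · simpa [Function.comp_def] using (hu _ hx').1.scomp x hd hm
  · simpa [Function.comp_def] using ((hu _ hx').2.scomp x hd hm).fun_neg

/-- The derivative of the Wronskian of solutions at two spectral parameters. -/
theorem hasDerivWithinAt_wronskian {l : ℂ} (hu : IsSolutionOn Q L k u u')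
    (hv : IsSolutionOn Q L l v v') {x : ℝ} (hx : x ∈ Icc 0 L) :
    HasDerivWithinAt (fun t => u t * v' t - u' t * v t) ((k ^ 2 - l ^ 2) * (u x * v x))
      (Icc 0 L) x := by
  exact (((hu x hx).1.fun_mul (hv x hx).2).fun_sub
    ((hu x hx).2.fun_mul (hv x hx).1)).congr_deriv (by ring)

theorem wronskian_eq (hu : IsSolutionOn Q L k u u') (hv : IsSolutionOn Q L k v v')
    {x y : ℝ} (hx : x ∈ Icc 0 L) (hy : y ∈ Icc 0 L) :
    u x * v' x - u' x * v x = u y * v' y - u' y * v y := by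
  have := (convex_Icc 0 L).norm_image_sub_le_of_norm_hasDerivWithin_le (C := 0)
    (fun t ht => hu.hasDerivWithinAt_wronskian hv ht) (fun t ht => by simp) hy hx
  simpa [sub_eq_zero] using this

theorem norm_le_of_norm_le (hu : IsSolutionOn Q L k u u') (hL : 0 ≤ L)
    (hB : ∀ x ∈ Icc 0 L, |Q x| ≤ B) (hk0 : k ≠ 0) (hk : 0 ≤ k.im) (hkB : 2 * (B * L) ≤ ‖k‖)
    {x : ℝ} (hx : x ∈ Icc 0 L) :
    ‖u x‖ ≤ 2 * (‖u 0‖ + ‖u' 0‖ / ‖k‖) * Real.exp (k.im * x) := by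
  have hkp : 0 < ‖k‖ := norm_pos_iff.2 hk0
  have hB0 : 0 ≤ B := (abs_nonneg _).trans (hB 0 ⟨le_rfl, hL⟩)
  obtain ⟨y, hy, hmax⟩ := isCompact_Icc.exists_isMaxOn (nonempty_Icc.2 hL)
    (f := fun t => ‖u t‖ * Real.exp (-(k.im * t)))
    (hu.continuousOn.norm.mul (by fun_prop))
  set M := ‖u y‖ * Real.exp (-(k.im * y)) with hM
  have hM0 : 0 ≤ M := by positivity
  have hle : ∀ t ∈ Icc 0 L, ‖u t‖ ≤ M * Real.exp (k.im * t) := by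
    intro t ht
    have := hmax ht
    simp only [mem_ofPred_eq] at this
    rw [Real.exp_neg, ← div_eq_mul_inv, div_le_iff₀ (Real.exp_pos _)] at this
    exact this
  have hS : ∀ t ∈ Icc 0 y, HasDerivWithinAt
      (fun t : ℝ => Complex.cos (k * (y - t)) * u t + Complex.sin (k * (y - t)) / k * u' t)
      (Complex.sin (k * (y - t)) / k * (Q t * u t)) (Icc 0 y) t := by
    intro t ht
    have htL : t ∈ Icc 0 L := ⟨ht.1, ht.2.trans hy.2⟩
    have hsub : Icc 0 y ⊆ Icc 0 L := Icc_subset_Icc_right hy.2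
    have hlin : HasDerivAt (fun z : ℂ => k * ((y : ℂ) - z)) (-k) t := by
      simpa using ((hasDerivAt_id (t : ℂ)).const_sub (y : ℂ)).const_mul k
    refine ((hlin.ccos.comp_ofReal.hasDerivWithinAt.fun_mul ((hu t htL).1.mono hsub)).fun_add
      ((hlin.csin.div_const k).comp_ofReal.hasDerivWithinAt.fun_mul
        ((hu t htL).2.mono hsub))).congr_deriv ?_
    field_simp
    ring
  have key := (convex_Icc 0 y).norm_image_sub_le_of_norm_hasDerivWithin_le
    (C := B * M / ‖k‖ * Real.exp (k.im * y)) hS (fun t ht => by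
      have htL : t ∈ Icc 0 L := ⟨ht.1, ht.2.trans hy.2⟩
      have h1 : ‖Complex.sin (k * (y - t))‖ ≤ Real.exp (k.im * (y - t)) := by
        have him : (k * (y - t : ℂ)).im = k.im * (y - t) := by simp
        rw [← him]
        exact norm_sin_le_exp_im (by rw [him]; exact mul_nonneg hk (by linarith [ht.2]))
      rw [norm_mul, norm_div, norm_mul, norm_real, Real.norm_eq_abs]
      calc _ ≤ Real.exp (k.im * (y - t)) / ‖k‖ * (B * (M * Real.exp (k.im * t))) := by
            gcongr
            · exact hB t htL
            · exact hle t htL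
        _ = B * M / ‖k‖ * (Real.exp (k.im * (y - t)) * Real.exp (k.im * t)) := by ring
        _ = _ := by rw [← Real.exp_add]; ring_nf) ⟨le_rfl, hy.1⟩ ⟨hy.1, le_rfl⟩
  simp only [sub_self, mul_zero, Complex.cos_zero, Complex.sin_zero, zero_div, zero_mul, add_zero,
    one_mul, ofReal_zero, sub_zero] at key
  have him : (k * (y : ℂ)).im = k.im * y := by simp
  have h0 : ‖Complex.cos (k * y) * u 0 + Complex.sin (k * y) / k * u' 0‖ ≤
      (‖u 0‖ + ‖u' 0‖ / ‖k‖) * Real.exp (k.im * y) := by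
    have hp : 0 ≤ (k * (y : ℂ)).im := by rw [him]; exact mul_nonneg hk hy.1
    have hc := norm_cos_le_exp_im hp
    have hs := norm_sin_le_exp_im hp
    rw [him] at hc hs
    refine (norm_add_le _ _).trans ?_
    rw [norm_mul, norm_mul, norm_div]
    calc _ ≤ Real.exp (k.im * y) * ‖u 0‖ + Real.exp (k.im * y) / ‖k‖ * ‖u' 0‖ := by gcongr
      _ = _ := by ring
  have hMy : ‖u y‖ = M * Real.exp (k.im * y) := by
    rw [hM, mul_assoc, ← Real.exp_add]; simp
  have hnn : ‖u y‖ ≤ ‖u y - (Complex.cos (k * y) * u 0 + Complex.sin (k * y) / k * u' 0)‖ +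
      ‖Complex.cos (k * y) * u 0 + Complex.sin (k * y) / k * u' 0‖ := by
    simpa using norm_add_le
      (u y - (Complex.cos (k * y) * u 0 + Complex.sin (k * y) / k * u' 0))
      (Complex.cos (k * y) * u 0 + Complex.sin (k * y) / k * u' 0)
  have hyn : ‖y‖ ≤ L := by rw [Real.norm_eq_abs, abs_of_nonneg hy.1]; exact hy.2
  have hsmall : B * M / ‖k‖ * ‖y‖ ≤ M / 2 := by
    calc _ ≤ B * M / ‖k‖ * L := by gcongr
      _ = (2 * (B * L)) * (M / 2) / ‖k‖ := by ring
      _ ≤ ‖k‖ * (M / 2) / ‖k‖ := by gcongr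
      _ = M / 2 := by field_simp
  have hfin : M * Real.exp (k.im * y) ≤
      (M / 2 + (‖u 0‖ + ‖u' 0‖ / ‖k‖)) * Real.exp (k.im * y) := by
    have := mul_le_mul_of_nonneg_right hsmall (Real.exp_pos (k.im * y)).le
    rw [← hMy, add_mul]
    calc _ ≤ _ := hnn
      _ ≤ _ := add_le_add (key.trans (le_of_eq_of_le (by ring) this)) h0
  have hMle := le_of_mul_le_mul_right hfin (Real.exp_pos _)
  calc _ ≤ _ := hle x hx
    _ ≤ _ := by gcongr; linarith

theorem norm_deriv_sub_le (hu : IsSolutionOn Q L k u u') (hL : 0 ≤ L)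
    (hB : ∀ x ∈ Icc 0 L, |Q x| ≤ B) (hk0 : k ≠ 0) (hk : 0 ≤ k.im) (hkB : 2 * (B * L) ≤ ‖k‖) :
    ‖u' L - (Complex.cos (k * L) * u' 0 - k * Complex.sin (k * L) * u 0)‖ ≤
      B * L * (2 * (‖u 0‖ + ‖u' 0‖ / ‖k‖)) * Real.exp (k.im * L) := by
  have hB0 : 0 ≤ B := (abs_nonneg _).trans (hB 0 ⟨le_rfl, hL⟩)
  have hS : ∀ t ∈ Icc 0 L, HasDerivWithinAt
      (fun t : ℝ => Complex.cos (k * (L - t)) * u' t - k * Complex.sin (k * (L - t)) * u t)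
      (Complex.cos (k * (L - t)) * (Q t * u t)) (Icc 0 L) t := by
    intro t ht
    have hlin : HasDerivAt (fun z : ℂ => k * ((L : ℂ) - z)) (-k) t := by
      simpa using ((hasDerivAt_id (t : ℂ)).const_sub (L : ℂ)).const_mul k
    refine ((hlin.ccos.comp_ofReal.hasDerivWithinAt.fun_mul (hu t ht).2).fun_sub
      ((hlin.csin.const_mul k).comp_ofReal.hasDerivWithinAt.fun_mul
        (hu t ht).1)).congr_deriv ?_
    ring
  have key := (convex_Icc 0 L).norm_image_sub_le_of_norm_hasDerivWithin_le
    (C := B * (2 * (‖u 0‖ + ‖u' 0‖ / ‖k‖)) * Real.exp (k.im * L)) hS (fun t ht => by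
      have h1 : ‖Complex.cos (k * (L - t))‖ ≤ Real.exp (k.im * (L - t)) := by
        have him : (k * (L - t : ℂ)).im = k.im * (L - t) := by simp
        rw [← him]
        exact norm_cos_le_exp_im (by rw [him]; exact mul_nonneg hk (by linarith [ht.2]))
      rw [norm_mul, norm_mul, norm_real, Real.norm_eq_abs]
      calc _ ≤ Real.exp (k.im * (L - t)) *
              (B * (2 * (‖u 0‖ + ‖u' 0‖ / ‖k‖) * Real.exp (k.im * t))) := by
            gcongr
            · exact hB t ht
            · exact hu.norm_le_of_norm_le hL hB hk0 hk hkB ht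
        _ = B * (2 * (‖u 0‖ + ‖u' 0‖ / ‖k‖)) *
              (Real.exp (k.im * (L - t)) * Real.exp (k.im * t)) := by ring
        _ = _ := by rw [← Real.exp_add]; ring_nf) ⟨le_rfl, hL⟩ ⟨hL, le_rfl⟩
  simp only [sub_self, mul_zero, Complex.cos_zero, Complex.sin_zero, zero_mul, one_mul,
    ofReal_zero, sub_zero, Real.norm_eq_abs, abs_of_nonneg hL] at key
  linarith

end IsSolutionOn

namespace IsSolutionOn

variable {Q : ℝ → ℝ} {L B : ℝ}

theorem norm_le_exp {k : ℂ} {u u' : ℝ → ℂ} (hu : IsSolutionOn Q L k u u')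
    (hB : ∀ x ∈ Icc 0 L, |Q x| ≤ B) {R : ℝ} (hR : ‖k‖ ≤ R) {x : ℝ} (hx : x ∈ Icc 0 L) :
    ‖u x‖ ≤ max ‖u 0‖ ‖u' 0‖ * Real.exp ((1 + B + R ^ 2) * L) := by
  have hB0 : 0 ≤ B := (abs_nonneg _).trans (hB x hx)
  have key := norm_le_gronwallBound_of_norm_deriv_right_le (a := 0) (b := L)
    (f := fun t => (u t, u' t)) (f' := fun t => (u' t, (Q t : ℂ) * u t - k ^ 2 * u t))
    (δ := max ‖u 0‖ ‖u' 0‖) (K := 1 + B + R ^ 2) (ε := 0)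
    (hu.continuousOn.prodMk hu.continuousOn_deriv)
    (fun t ht => by
      have h := hu t ⟨ht.1, ht.2.le⟩
      exact (h.1.prodMk h.2).mono_of_mem_nhdsWithin (Icc_mem_nhdsGE_of_mem ht))
    (by simp [Prod.norm_def])
    (fun t ht => by
      have hQ : ‖(Q t : ℂ)‖ ≤ B := by
        rw [norm_real, Real.norm_eq_abs]; exact hB t ⟨ht.1, ht.2.le⟩
      have h1 : ‖u t‖ ≤ ‖(u t, u' t)‖ := norm_fst_le (u t, u' t)
      have h2 : ‖u' t‖ ≤ ‖(u t, u' t)‖ := norm_snd_le (u t, u' t)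
      have h3 : ‖(Q t : ℂ) * u t - k ^ 2 * u t‖ ≤ (B + R ^ 2) * ‖(u t, u' t)‖ := by
        rw [← sub_mul, norm_mul]
        gcongr
        refine (norm_sub_le _ _).trans ?_
        rw [norm_pow]
        gcongr
      have h4 : 0 ≤ ‖(u t, u' t)‖ := norm_nonneg _
      rw [add_zero, Prod.norm_def]
      refine max_le ?_ ?_
      · nlinarith [sq_nonneg R]
      · nlinarith)
    x hx
  rw [gronwallBound_ε0, sub_zero] at key
  refine (norm_fst_le (u x, u' x)).trans (key.trans ?_)
  have : 0 ≤ max ‖u 0‖ ‖u' 0‖ := le_max_of_le_left (norm_nonneg _)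
  gcongr
  exact hx.2

theorem eq_add_integral {k l : ℂ} {u u' v v' w w' : ℝ → ℂ} (hu : IsSolutionOn Q L k u u')
    (hv : IsSolutionOn Q L l v v') (hw : IsSolutionOn Q L l w w')
    (h0 : u 0 = v 0) (h0' : u' 0 = v' 0) {x : ℝ} (hx : x ∈ Icc 0 L) (hwx : w x = 0)
    (hwx' : w' x = 1) :
    u x = v x + (k ^ 2 - l ^ 2) * ∫ t in (0 : ℝ)..x, u t * w t := by
  have hsub : Icc 0 x ⊆ Icc 0 L := Icc_subset_Icc_right hx.2
  have hcont : ContinuousOn (fun t => (k ^ 2 - l ^ 2) * (u t * w t)) (Icc 0 x) :=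
    continuousOn_const.mul ((hu.continuousOn.mul hw.continuousOn).mono hsub)
  have key := intervalIntegral.integral_eq_sub_of_hasDerivAt_of_le hx.1
    (f := fun t => u t * w' t - u' t * w t) (f' := fun t => (k ^ 2 - l ^ 2) * (u t * w t))
    (fun t ht => ((hu.hasDerivWithinAt_wronskian hw (hsub ht)).continuousWithinAt).mono hsub)
    (fun t ht => (hu.hasDerivWithinAt_wronskian hw (hsub ⟨ht.1.le, ht.2.le⟩)).hasDerivAt
      (Icc_mem_nhds ht.1 (ht.2.trans_le hx.2)))
    (hcont.intervalIntegrable_of_Icc hx.1)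
  have hvw := hv.wronskian_eq hw hx ⟨le_rfl, hx.1.trans hx.2⟩
  rw [intervalIntegral.integral_const_mul] at key
  rw [key]
  simp only [hwx, hwx', h0, h0', mul_one, mul_zero, sub_zero] at hvw ⊢
  rw [← hvw]
  ring

/-- Solutions with fixed initial data at `0` depend holomorphically on the parameter. -/
theorem differentiableAt_param {u u' : ℂ → ℝ → ℂ} {a b l : ℂ}
    (hu : ∀ k ≠ 0, IsSolutionOn Q L k (u k) (u' k)) (h0 : ∀ k ≠ 0, u k 0 = a)
    (h0' : ∀ k ≠ 0, u' k 0 = b) (hB : ∀ x ∈ Icc 0 L, |Q x| ≤ B) (hl : l ≠ 0)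
    (hex : ∀ x ∈ Icc 0 L, ∃ w w', IsSolutionOn Q L l w w' ∧ w x = 0 ∧ w' x = 1)
    {x : ℝ} (hx : x ∈ Icc 0 L) : DifferentiableAt ℂ (fun k => u k x) l := by
  have hev : ∀ᶠ k in 𝓝 l, k ≠ 0 ∧ ‖k‖ ≤ ‖l‖ + 1 := by
    refine Filter.Eventually.and (isOpen_ne.mem_nhds hl) ?_
    filter_upwards [Metric.ball_mem_nhds l one_pos] with k hk
    have := norm_sub_norm_le k l
    rw [mem_ball_iff_norm] at hk
    linarith
  set C := max ‖a‖ ‖b‖ * Real.exp ((1 + B + (‖l‖ + 1) ^ 2) * L) with hC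
  have hbound : ∀ᶠ k in 𝓝 l, k ≠ 0 ∧ ∀ t ∈ Icc 0 L, ‖u k t‖ ≤ C := by
    filter_upwards [hev] with k hk
    refine ⟨hk.1, fun t ht => ?_⟩
    have := (hu k hk.1).norm_le_exp hB hk.2 ht
    rwa [h0 k hk.1, h0' k hk.1] at this
  have hsq : Tendsto (fun k : ℂ => k ^ 2 - l ^ 2) (𝓝 l) (𝓝 0) := by
    have : Continuous fun k : ℂ => k ^ 2 - l ^ 2 := by fun_prop
    simpa using this.tendsto l
  have hwb : ∀ w w' : ℝ → ℂ, IsSolutionOn Q L l w w' → ∃ D, ∀ t ∈ Icc 0 L, ‖w t‖ ≤ D :=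
    fun w w' hw => isCompact_Icc.exists_bound_of_continuousOn hw.continuousOn
  have hlim : ∀ t ∈ Icc 0 L, Tendsto (fun k => u k t) (𝓝 l) (𝓝 (u l t)) := by
    intro t ht
    obtain ⟨w, w', hw, hwx, hwx'⟩ := hex t ht
    obtain ⟨D, hD⟩ := hwb w w' hw
    rw [tendsto_iff_norm_sub_tendsto_zero]
    refine squeeze_zero' (g := fun k => ‖k ^ 2 - l ^ 2‖ * (C * D * |t - 0|))
      (Eventually.of_forall fun _ => norm_nonneg _) ?_ (by simpa using hsq.norm.mul_const _)
    filter_upwards [hbound] with k hk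
    rw [(hu k hk.1).eq_add_integral (hu l hl) hw (by rw [h0 k hk.1, h0 l hl])
      (by rw [h0' k hk.1, h0' l hl]) ht hwx hwx', add_sub_cancel_left, norm_mul]
    gcongr
    refine intervalIntegral.norm_integral_le_of_norm_le_const fun s hs => ?_
    rw [uIoc_of_le ht.1] at hs
    have hs' : s ∈ Icc 0 L := ⟨hs.1.le, hs.2.trans ht.2⟩
    rw [norm_mul]
    exact mul_le_mul (hk.2 s hs') (hD s hs') (norm_nonneg _)
      ((norm_nonneg _).trans (hk.2 s hs'))
  obtain ⟨w, w', hw, hwx, hwx'⟩ := hex x hx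
  obtain ⟨D, hD⟩ := hwb w w' hw
  have hIoc : ∀ s ∈ uIoc 0 x, s ∈ Icc 0 L := fun s hs => by
    rw [uIoc_of_le hx.1] at hs
    exact ⟨hs.1.le, hs.2.trans hx.2⟩
  have hint : Tendsto (fun k => ∫ t in (0 : ℝ)..x, u k t * w t) (𝓝 l)
      (𝓝 (∫ t in (0 : ℝ)..x, u l t * w t)) := by
    refine intervalIntegral.tendsto_integral_filter_of_dominated_convergence (fun _ => C * D)
      ?_ ?_ intervalIntegrable_const ?_
    · filter_upwards [hbound] with k hk
      exact (((hu k hk.1).continuousOn.mul hw.continuousOn).mono hIoc).aestronglyMeasurable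
        measurableSet_uIoc
    · filter_upwards [hbound] with k hk
      refine Eventually.of_forall fun s hs => ?_
      rw [norm_mul]
      exact mul_le_mul (hk.2 s (hIoc s hs)) (hD s (hIoc s hs)) (norm_nonneg _)
        ((norm_nonneg _).trans (hk.2 s (hIoc s hs)))
    · exact Eventually.of_forall fun s hs => (hlim s (hIoc s hs)).mul_const _
  have hder : HasDerivAt (fun k => u k x)
      ((l + l) * ∫ t in (0 : ℝ)..x, u l t * w t) l := by
    rw [hasDerivAt_iff_tendsto_slope]
    have h1 : Tendsto (fun k : ℂ => (k + l) * ∫ t in (0 : ℝ)..x, u k t * w t) (𝓝[≠] l)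
        (𝓝 ((l + l) * ∫ t in (0 : ℝ)..x, u l t * w t)) :=
      (((continuous_id.add continuous_const).tendsto l).mul hint).mono_left nhdsWithin_le_nhds
    refine h1.congr' ?_
    filter_upwards [nhdsWithin_le_nhds hbound, self_mem_nhdsWithin] with k hk hkl
    have hkl' : k - l ≠ 0 := sub_ne_zero.2 hkl
    rw [slope_def_field, (hu k hk.1).eq_add_integral (hu l hl) hw (by rw [h0 k hk.1, h0 l hl])
      (by rw [h0' k hk.1, h0' l hl]) hx hwx hwx']
    field_simp
    ring
  exact hder.differentiableAt

end IsSolutionOn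

/-- A Liouville theorem for even functions holomorphic off the origin. -/
theorem eq_zero_of_even_of_decay {F : ℂ → ℂ} (hd : ∀ k ≠ 0, DifferentiableAt ℂ F k)
    (hb : ∀ R : ℝ, ∃ C, ∀ k ≠ 0, ‖k‖ ≤ R → ‖F k‖ ≤ C) (he : ∀ k ≠ 0, F (-k) = F k)
    {R C : ℝ} (hdecay : ∀ k : ℂ, 0 < k.im → R ≤ ‖k‖ → ‖F k‖ ≤ C / ‖k‖) {k : ℂ} (hk : k ≠ 0) :
    F k = 0 := by
  set R' := max R 1 with hR'
  have hR1 : 1 ≤ R' := le_max_right _ _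
  obtain ⟨C', hC'⟩ := hb R'
  have hup : ∀ k : ℂ, 0 < k.im → R' ≤ ‖k‖ → ‖F k‖ ≤ |C| := fun k hk hkR => by
    have h1 : (1 : ℝ) ≤ ‖k‖ := hR1.trans hkR
    calc _ ≤ C / ‖k‖ := hdecay k hk ((le_max_left _ _).trans hkR)
      _ ≤ |C| / ‖k‖ := by gcongr; exact le_abs_self C
      _ ≤ |C| := div_le_self (abs_nonneg _) h1
  have hall : ∀ k : ℂ, k ≠ 0 → ‖F k‖ ≤ max |C| C' := by
    intro k hk
    rcases le_or_gt ‖k‖ R' with hkR | hkR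
    · exact le_max_of_le_right (hC' k hk hkR)
    refine le_max_of_le_left ?_
    rcases lt_trichotomy k.im 0 with him | him | him
    · rw [← he k hk]
      exact hup (-k) (by simpa using him) (by simpa using hkR.le)
    · have ht : Tendsto (fun t : ℝ => k + t * I) (𝓝[>] 0) (𝓝 k) := by
        have : Continuous fun t : ℝ => k + t * I := by fun_prop
        simpa using (this.tendsto 0).mono_left nhdsWithin_le_nhds
      refine le_of_tendsto (((hd k hk).continuousAt.tendsto.comp ht).norm) ?_
      filter_upwards [self_mem_nhdsWithin,
        ht.norm.eventually (lt_mem_nhds hkR)] with t ht0 htR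
      exact hup _ (by simpa [him] using ht0) htR.le
    · exact hup k him hkR.le
  have hU := differentiableOn_update_limUnder_of_bddAbove (f := F) (s := univ) (c := 0)
    univ_mem (fun z hz => (hd z hz.2).differentiableWithinAt)
    ⟨max |C| C', by rintro _ ⟨z, hz, rfl⟩; exact hall z hz.2⟩
  rw [differentiableOn_univ] at hU
  set G := Function.update F 0 (limUnder (𝓝[≠] 0) F) with hG
  have hGF : ∀ z ≠ 0, G z = F z := fun z hz => Function.update_of_ne hz _ _
  have hbd : Bornology.IsBounded (range G) := by
    rw [isBounded_iff_forall_norm_le]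
    refine ⟨max (max |C| C') ‖G 0‖, ?_⟩
    rintro _ ⟨z, rfl⟩
    by_cases hz : z = 0
    · rw [hz]; exact le_max_right _ _
    · rw [hGF z hz]; exact le_max_of_le_left (hall z hz)
  have hconst : ∀ z ≠ 0, F k = F z := fun z hz => by
    rw [← hGF k hk, ← hGF z hz]; exact hU.apply_eq_apply_of_bounded hbd k z
  have hle : ∀ᶠ t : ℝ in atTop, ‖F k‖ ≤ |C| / t := by
    filter_upwards [eventually_ge_atTop R'] with t ht
    have ht0 : 0 < t := by linarith
    have hn : ‖(t : ℂ) * I‖ = t := by simp [abs_of_pos ht0]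
    rw [hconst (t * I) (by simp [ht0.ne'])]
    calc _ ≤ C / ‖(t : ℂ) * I‖ := hdecay _ (by simpa using ht0)
          (by rw [hn]; exact (le_max_left _ _).trans ht)
      _ ≤ _ := by rw [hn]; gcongr; exact le_abs_self C
  have := ge_of_tendsto (tendsto_const_nhds.div_atTop tendsto_id) hle
  simpa using this

namespace IsSolutionOn

variable {Q P : ℝ → ℝ} {L : ℝ} {k c : ℂ} {u u' v v' u₁ u₁' u₂ u₂' v₁ v₁' v₂ v₂' : ℝ → ℂ}

/-- If two pairs of solutions with the same constant Wronskian have equal ratios, then their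
first components agree up to sign. -/
theorem sq_eq_sq (hu₁ : IsSolutionOn Q L k u₁ u₁') (hv₁ : IsSolutionOn Q L k v₁ v₁')
    (hu₂ : IsSolutionOn P L k u₂ u₂') (hv₂ : IsSolutionOn P L k v₂ v₂') (hL : 0 < L) (hc : c ≠ 0)
    (hW₁ : ∀ x ∈ Icc 0 L, u₁ x * v₁' x - u₁' x * v₁ x = c)
    (hW₂ : ∀ x ∈ Icc 0 L, u₂ x * v₂' x - u₂' x * v₂ x = c)
    (h : ∀ x ∈ Icc 0 L, u₁ x * v₂ x = u₂ x * v₁ x) {x : ℝ} (hx : x ∈ Icc 0 L) :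
    u₁ x ^ 2 = u₂ x ^ 2 := by
  have hd := (uniqueDiffOn_Icc hL x hx).eq_deriv _
    ((hu₁ x hx).1.fun_mul (hv₂ x hx).1)
    (((hu₂ x hx).1.fun_mul (hv₁ x hx).1).congr h (h x hx))
  refine mul_left_cancel₀ hc ?_
  linear_combination (-u₁ x ^ 2) * hW₂ x hx + u₂ x ^ 2 * hW₁ x hx + u₁ x * u₂ x * hd -
    (u₁' x * u₂ x + u₁ x * u₂' x) * h x hx

theorem potential_eq_of_sq_eq_sq (hu : IsSolutionOn Q L k u u') (hv : IsSolutionOn P L k v v')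
    (hL : 0 < L) (h : ∀ x ∈ Icc 0 L, u x ^ 2 = v x ^ 2) {x : ℝ} (hx : x ∈ Icc 0 L)
    (hne : u x ≠ 0) : Q x = P x := by
  have h1 : ∀ t ∈ Icc 0 L, u t * u' t = v t * v' t := fun t ht => by
    have := (uniqueDiffOn_Icc hL t ht).eq_deriv _
      ((hu t ht).1.fun_pow 2) (((hv t ht).1.fun_pow 2).congr h (h t ht))
    push_cast at this
    linear_combination this / 2
  have h2 := (uniqueDiffOn_Icc hL x hx).eq_deriv _
    ((hu x hx).1.fun_mul (hu x hx).2)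
    (((hv x hx).1.fun_mul (hv x hx).2).congr h1 (h1 x hx))
  have h3 : ((Q x : ℂ) - P x) * u x ^ 4 = 0 := by
    linear_combination u x ^ 2 * h2 - (u x * u' x + v x * v' x) * h1 x hx +
      (v' x ^ 2 - u x ^ 2 * (P x - k ^ 2)) * h x hx
  have h4 := (mul_eq_zero.1 h3).resolve_right (pow_ne_zero 4 hne)
  exact_mod_cast sub_eq_zero.1 h4

end IsSolutionOn

namespace IsJostSolution

variable {W : ℝ → ℝ} {xI B : ℝ} {k : ℂ} {f f' : ℝ → ℂ}

theorem isSolutionOn (hf : IsJostSolution W xI k f f') : IsSolutionOn W xI k f f' :=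
  fun x hx => ⟨(hf.1 x hx.1).mono Icc_subset_Ici_self, (hf.2.1 x hx.1).mono Icc_subset_Ici_self⟩

theorem deriv_right_end (hf : IsJostSolution W xI k f f') (hxI : 0 ≤ xI) :
    f' xI = I * k * cexp (I * k * xI) := by
  have h1 : HasDerivWithinAt f (f' xI) (Ici xI) xI := (hf.1 xI hxI).mono (Ici_subset_Ici.2 hxI)
  have h2 : HasDerivAt (fun x : ℝ => cexp (I * k * x)) (cexp (I * k * xI) * (I * k)) xI := by
    have : HasDerivAt (fun z : ℂ => I * k * z) (I * k) xI := by
      simpa using (hasDerivAt_id (xI : ℂ)).const_mul (I * k)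
    exact this.cexp.comp_ofReal
  have h3 := (uniqueDiffOn_Ici xI xI self_mem_Ici).eq_deriv _ h1
    (h2.hasDerivWithinAt.congr (fun x hx => hf.2.2 x hx) (hf.2.2 xI le_rfl))
  rw [h3, mul_comm]

theorem norm_right_end (hf : IsJostSolution W xI k f f') :
    ‖f xI‖ = Real.exp (-(k.im * xI)) := by
  rw [hf.2.2 xI le_rfl, norm_exp]
  simp

theorem norm_deriv_right_end (hf : IsJostSolution W xI k f f') (hxI : 0 ≤ xI) :
    ‖f' xI‖ = ‖k‖ * Real.exp (-(k.im * xI)) := by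
  rw [hf.deriv_right_end hxI, ← hf.2.2 xI le_rfl, norm_mul, hf.norm_right_end]
  simp

theorem norm_le_exp_neg (hf : IsJostSolution W xI k f f') (hxI : 0 ≤ xI)
    (hB : ∀ x ∈ Icc 0 xI, |W x| ≤ B) (hk0 : k ≠ 0) (hk : 0 ≤ k.im) (hkB : 2 * (B * xI) ≤ ‖k‖)
    {x : ℝ} (hx : x ∈ Icc 0 xI) : ‖f x‖ ≤ 4 * Real.exp (-(k.im * x)) := by
  have hm : ∀ y ∈ Icc 0 xI, xI - y ∈ Icc 0 xI :=
    fun y hy => ⟨by linarith [hy.2], by linarith [hy.1]⟩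
  have key := hf.isSolutionOn.reflect.norm_le_of_norm_le hxI (fun y hy => hB _ (hm y hy))
    hk0 hk hkB (hm x hx)
  have hkn : ‖k‖ ≠ 0 := norm_ne_zero_iff.2 hk0
  simp only [sub_sub_cancel, sub_zero, norm_neg, hf.norm_right_end,
    hf.norm_deriv_right_end hxI] at key
  refine key.trans (le_of_eq ?_)
  rw [mul_div_cancel_left₀ _ hkn, ← two_mul, ← mul_assoc, mul_assoc, ← Real.exp_add]
  ring_nf

theorem norm_deriv_zero_sub_le (hf : IsJostSolution W xI k f f') (hxI : 0 ≤ xI)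
    (hB : ∀ x ∈ Icc 0 xI, |W x| ≤ B) (hk0 : k ≠ 0) (hk : 0 ≤ k.im)
    (hkB : 2 * (B * xI) ≤ ‖k‖) : ‖f' 0 - I * k‖ ≤ 4 * (B * xI) := by
  have hm : ∀ y ∈ Icc 0 xI, xI - y ∈ Icc 0 xI :=
    fun y hy => ⟨by linarith [hy.2], by linarith [hy.1]⟩
  have key := hf.isSolutionOn.reflect.norm_deriv_sub_le hxI (fun y hy => hB _ (hm y hy))
    hk0 hk hkB
  have hkn : ‖k‖ ≠ 0 := norm_ne_zero_iff.2 hk0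
  simp only [sub_self, sub_zero, norm_neg, hf.norm_right_end,
    hf.norm_deriv_right_end hxI] at key
  have h1 : Complex.cos (k * xI) * -f' xI - k * Complex.sin (k * xI) * f xI = -(I * k) := by
    rw [hf.deriv_right_end hxI, hf.2.2 xI le_rfl]
    have h2 : cexp (I * k * xI) = Complex.cos (k * xI) + Complex.sin (k * xI) * I := by
      rw [← Complex.exp_mul_I]; ring_nf
    rw [h2]
    linear_combination (-(I * k)) * Complex.sin_sq_add_cos_sq (k * xI) +
      (-(k * Complex.sin (k * xI) * Complex.cos (k * xI))) * I_sq
  rw [h1, ← neg_add', norm_neg, ← sub_eq_add_neg] at key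
  refine key.trans (le_of_eq ?_)
  rw [mul_div_cancel_left₀ _ hkn, ← two_mul, ← mul_assoc, ← mul_assoc, mul_assoc, ← Real.exp_add]
  simp
  ring

end IsJostSolution

theorem half_norm_le_norm_jostFn {W : ℝ → ℝ} {xI B h : ℝ} {k : ℂ} {f f' : ℂ → ℝ → ℂ}
    (hf : IsJostSolution W xI k (f k) (f' k)) (hxI : 0 ≤ xI)
    (hB : ∀ x ∈ Icc 0 xI, |W x| ≤ B) (hk0 : k ≠ 0) (hk : 0 ≤ k.im)
    (hkB : 8 * (B * xI) + 8 * |h| ≤ ‖k‖) : ‖k‖ / 2 ≤ ‖jostFn h f f' k‖ := by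
  have hB0 : 0 ≤ B := (abs_nonneg _).trans (hB 0 ⟨le_rfl, hxI⟩)
  have hBx : 0 ≤ B * xI := mul_nonneg hB0 hxI
  have hkB' : 2 * (B * xI) ≤ ‖k‖ := by linarith [abs_nonneg h]
  have h1 := hf.norm_le_exp_neg hxI hB hk0 hk hkB' ⟨le_rfl, hxI⟩
  have h2 := hf.norm_deriv_zero_sub_le hxI hB hk0 hk hkB'
  simp only [mul_zero, neg_zero, Real.exp_zero, mul_one] at h1
  have h3 : ‖k‖ = ‖jostFn h f f' k - ((h : ℂ) * f k 0 + (f' k 0 - I * k))‖ := by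
    rw [jostFn]
    ring_nf
    simp
  have h4 : ‖(h : ℂ) * f k 0‖ ≤ |h| * 4 := by
    rw [norm_mul, norm_real, Real.norm_eq_abs]
    gcongr
  have h5 := norm_sub_le (jostFn h f f' k) ((h : ℂ) * f k 0 + (f' k 0 - I * k))
  have h6 := norm_add_le ((h : ℂ) * f k 0) (f' k 0 - I * k)
  linarith

/-- The solutions `φ`, `θ` of the initial value problems `φ(0) = 1`, `φ'(0) = -h` and
`θ(0) = 0`, `θ'(0) = 1`, for all nonzero spectral parameters. -/
structure IsFundamentalSystem (Q : ℝ → ℝ) (L h : ℝ) (φ φ' θ θ' : ℂ → ℝ → ℂ) : Prop where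
  left : ∀ k ≠ 0, IsSolutionOn Q L k (φ k) (φ' k)
  right : ∀ k ≠ 0, IsSolutionOn Q L k (θ k) (θ' k)
  left_zero : ∀ k ≠ 0, φ k 0 = 1
  left_deriv_zero : ∀ k ≠ 0, φ' k 0 = -h
  right_zero : ∀ k ≠ 0, θ k 0 = 0
  right_deriv_zero : ∀ k ≠ 0, θ' k 0 = 1

namespace IsFundamentalSystem

variable {Q : ℝ → ℝ} {L h B : ℝ} {φ φ' θ θ' : ℂ → ℝ → ℂ}

theorem wronskian (hs : IsFundamentalSystem Q L h φ φ' θ θ') {k : ℂ} (hk : k ≠ 0) {x : ℝ}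
    (hx : x ∈ Icc 0 L) : φ k x * θ' k x - φ' k x * θ k x = 1 := by
  rw [(hs.left k hk).wronskian_eq (hs.right k hk) hx ⟨le_rfl, hx.1.trans hx.2⟩,
    hs.left_zero k hk, hs.right_zero k hk, hs.right_deriv_zero k hk]
  simp

theorem exists_solution (hs : IsFundamentalSystem Q L h φ φ' θ θ') {k : ℂ} (hk : k ≠ 0) :
    ∀ x ∈ Icc 0 L, ∃ w w', IsSolutionOn Q L k w w' ∧ w x = 0 ∧ w' x = 1 := fun x hx =>
  ⟨_, _, (hs.left k hk).linear_comb (hs.right k hk) (-θ k x) (φ k x), by ring, by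
    linear_combination hs.wronskian hk hx⟩

theorem differentiableAt_left (hs : IsFundamentalSystem Q L h φ φ' θ θ')
    (hB : ∀ x ∈ Icc 0 L, |Q x| ≤ B) {k : ℂ} (hk : k ≠ 0) {x : ℝ} (hx : x ∈ Icc 0 L) :
    DifferentiableAt ℂ (fun k => φ k x) k :=
  IsSolutionOn.differentiableAt_param hs.left hs.left_zero hs.left_deriv_zero hB hk
    (hs.exists_solution hk) hx

theorem differentiableAt_right (hs : IsFundamentalSystem Q L h φ φ' θ θ')
    (hB : ∀ x ∈ Icc 0 L, |Q x| ≤ B) {k : ℂ} (hk : k ≠ 0) {x : ℝ} (hx : x ∈ Icc 0 L) :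
    DifferentiableAt ℂ (fun k => θ k x) k :=
  IsSolutionOn.differentiableAt_param hs.right hs.right_zero hs.right_deriv_zero hB hk
    (hs.exists_solution hk) hx

theorem exists_bound (hs : IsFundamentalSystem Q L h φ φ' θ θ')
    (hB : ∀ x ∈ Icc 0 L, |Q x| ≤ B) (R : ℝ) :
    ∃ C, ∀ k ≠ 0, ‖k‖ ≤ R → ∀ x ∈ Icc 0 L, ‖φ k x‖ ≤ C ∧ ‖θ k x‖ ≤ C := by
  refine ⟨max (max ‖(1 : ℂ)‖ ‖(-h : ℂ)‖ * Real.exp ((1 + B + R ^ 2) * L))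
    (max ‖(0 : ℂ)‖ ‖(1 : ℂ)‖ * Real.exp ((1 + B + R ^ 2) * L)), fun k hk hkR x hx => ⟨?_, ?_⟩⟩
  · have := (hs.left k hk).norm_le_exp hB hkR hx
    rw [hs.left_zero k hk, hs.left_deriv_zero k hk] at this
    exact le_max_of_le_left this
  · have := (hs.right k hk).norm_le_exp hB hkR hx
    rw [hs.right_zero k hk, hs.right_deriv_zero k hk] at this
    exact le_max_of_le_right this

theorem norm_left_le (hs : IsFundamentalSystem Q L h φ φ' θ θ')
    (hB : ∀ x ∈ Icc 0 L, |Q x| ≤ B) {k : ℂ} (hk : 0 ≤ k.im) (hk1 : 1 ≤ ‖k‖)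
    (hkB : 2 * (B * L) ≤ ‖k‖) {x : ℝ} (hx : x ∈ Icc 0 L) :
    ‖φ k x‖ ≤ 2 * (1 + |h|) * Real.exp (k.im * x) := by
  have hk0 : k ≠ 0 := norm_pos_iff.1 (by linarith)
  have key := (hs.left k hk0).norm_le_of_norm_le (hx.1.trans hx.2) hB hk0 hk hkB hx
  rw [hs.left_zero k hk0, hs.left_deriv_zero k hk0, norm_one, norm_neg, norm_real,
    Real.norm_eq_abs] at key
  refine key.trans ?_
  gcongr
  exact div_le_self (abs_nonneg h) hk1

end IsFundamentalSystem

theorem exists_isFundamentalSystem {W : ℝ → ℝ} {xI : ℝ} (h : ℝ) (hxI : 0 ≤ xI)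
    {f fd : ℂ → ℝ → ℂ} (hf : ∀ k : ℂ, IsJostSolution W xI k (f k) (fd k)) :
    ∃ φ φ' θ θ', IsFundamentalSystem W xI h φ φ' θ θ' ∧
      (∀ k x, φ (-k) x = φ k x) ∧ (∀ k x, θ (-k) x = θ k x) ∧
      ∀ k ≠ 0, ∀ x, f k x = f k 0 * φ k x + jostFn h f fd k * θ k x := by
  have hW : ∀ k, f k 0 * fd (-k) 0 - fd k 0 * f (-k) 0 = -(2 * I * k) := fun k => by
    have he : cexp (I * k * xI) * cexp (I * -k * xI) = 1 := by
      rw [← Complex.exp_add]; simp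
    rw [(hf k).isSolutionOn.wronskian_eq (hf (-k)).isSolutionOn.neg_param
      ⟨le_rfl, hxI⟩ ⟨hxI, le_rfl⟩, (hf k).deriv_right_end hxI, (hf (-k)).deriv_right_end hxI,
      (hf k).2.2 xI le_rfl, (hf (-k)).2.2 xI le_rfl]
    linear_combination (-(2 * I * k)) * he
  set J := jostFn h f fd with hJ
  have hJd : ∀ k, J k = h * f k 0 + fd k 0 := fun k => rfl
  have h2 : ∀ k : ℂ, k ≠ 0 → 2 * I * k ≠ 0 := fun k hk => by simp [hk]
  refine ⟨fun k x => -J (-k) / (2 * I * k) * f k x + J k / (2 * I * k) * f (-k) x,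
    fun k x => -J (-k) / (2 * I * k) * fd k x + J k / (2 * I * k) * fd (-k) x,
    fun k x => f (-k) 0 / (2 * I * k) * f k x + -f k 0 / (2 * I * k) * f (-k) x,
    fun k x => f (-k) 0 / (2 * I * k) * fd k x + -f k 0 / (2 * I * k) * fd (-k) x,
    ⟨fun k _ => (hf k).isSolutionOn.linear_comb (hf (-k)).isSolutionOn.neg_param _ _,
      fun k _ => (hf k).isSolutionOn.linear_comb (hf (-k)).isSolutionOn.neg_param _ _,
      fun k hk => ?_, fun k hk => ?_, fun k hk => ?_, fun k hk => ?_⟩,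
      fun k x => ?_, fun k x => ?_, fun k hk x => ?_⟩
  · have h2k := h2 k hk
    calc _ = -(f k 0 * fd (-k) 0 - fd k 0 * f (-k) 0) / (2 * I * k) := by
          rw [hJd, hJd]; ring
      _ = 1 := by rw [hW, neg_neg, div_self h2k]
  · have h2k := h2 k hk
    calc _ = h * (f k 0 * fd (-k) 0 - fd k 0 * f (-k) 0) / (2 * I * k) := by
          rw [hJd, hJd]; ring
      _ = -h := by rw [hW, mul_neg, neg_div, mul_div_cancel_right₀ _ h2k]
  · ring
  · have h2k := h2 k hk
    calc _ = -(f k 0 * fd (-k) 0 - fd k 0 * f (-k) 0) / (2 * I * k) := by ring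
      _ = 1 := by rw [hW, neg_neg, div_self h2k]
  · simp only [neg_neg, mul_neg, div_neg]; ring
  · simp only [neg_neg, mul_neg, div_neg]; ring
  · have h2k := h2 k hk
    have : f k x = -(f k 0 * fd (-k) 0 - fd k 0 * f (-k) 0) / (2 * I * k) * f k x := by
      rw [hW, neg_neg, div_self h2k, one_mul]
    simp only [hJd]
    refine this.trans ?_
    ring

/-- The cross product of the fundamental systems is controlled by the Weyl solutions as soon as
the Weyl functions agree. -/
theorem norm_cross_le {φ₁ θ₁ φ₂ θ₂ f₁ f₂ a₁ a₂ J₁ J₂ : ℂ} {A E K : ℝ} (hE : 0 < E) (hK : 0 < K)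
    (h₁ : f₁ = a₁ * φ₁ + J₁ * θ₁) (h₂ : f₂ = a₂ * φ₂ + J₂ * θ₂)
    (hJ₁ : K / 2 ≤ ‖J₁‖) (hJ₂ : K / 2 ≤ ‖J₂‖) (hM : J₁ * J₂ ≠ 0 → a₁ / J₁ = a₂ / J₂)
    (hφ₁ : ‖φ₁‖ ≤ A * E) (hφ₂ : ‖φ₂‖ ≤ A * E) (hf₁ : ‖f₁‖ ≤ 4 * E⁻¹) (hf₂ : ‖f₂‖ ≤ 4 * E⁻¹) :
    ‖φ₁ * θ₂ - φ₂ * θ₁‖ ≤ 16 * A / K := by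
  have hn₁ : J₁ ≠ 0 := norm_pos_iff.1 (by linarith)
  have hn₂ : J₂ ≠ 0 := norm_pos_iff.1 (by linarith)
  have hM' := hM (mul_ne_zero hn₁ hn₂)
  have hF : φ₁ * θ₂ - φ₂ * θ₁ = φ₁ * (f₂ / J₂) - φ₂ * (f₁ / J₁) := by
    have e₁ : f₁ / J₁ = a₁ / J₁ * φ₁ + θ₁ := by rw [h₁]; field_simp
    have e₂ : f₂ / J₂ = a₂ / J₂ * φ₂ + θ₂ := by rw [h₂]; field_simp
    rw [e₁, e₂, hM']
    ring
  have hq : ∀ {p J : ℂ}, ‖p‖ ≤ 4 * E⁻¹ → K / 2 ≤ ‖J‖ → ‖p / J‖ ≤ 4 * E⁻¹ / (K / 2) :=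
    fun hp hJ => by rw [norm_div]; gcongr
  have hAE : 0 ≤ A * E := (norm_nonneg _).trans hφ₁
  calc _ ≤ ‖φ₁‖ * ‖f₂ / J₂‖ + ‖φ₂‖ * ‖f₁ / J₁‖ := by
        rw [hF, ← norm_mul, ← norm_mul]; exact norm_sub_le _ _
    _ ≤ A * E * (4 * E⁻¹ / (K / 2)) + A * E * (4 * E⁻¹ / (K / 2)) := by
        gcongr
        · exact hq hf₂ hJ₂
        · exact hq hf₁ hJ₁
    _ = 16 * A / K := by field_simp; ring

/-- Borg–Marchenko type uniqueness: if the Weyl functions of two potentials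
coincide, then the potentials coincide (a.e. on `[0,∞)`). -/
theorem weyl_uniqueness
    (xI h : ℝ) (hxI : 0 < xI) (V Vd W Wd : ℝ → ℝ)
    (hV : IntegrableOn V (Set.Ioi 0)) (hVd : IntegrableOn Vd (Set.Ioi 0))
    (hW : IntegrableOn W (Set.Ioi 0)) (hWd : IntegrableOn Wd (Set.Ioi 0))
    (hsuppV : Function.support V ⊆ Set.Icc 0 xI)
    (hsuppVd : Function.support Vd ⊆ Set.Icc 0 xI)
    (hsuppW : Function.support W ⊆ Set.Icc 0 xI)
    (hsuppWd : Function.support Wd ⊆ Set.Icc 0 xI)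
    (hVderiv : ∀ x ∈ Set.Ici (0 : ℝ), HasDerivWithinAt V (Vd x) (Set.Ici 0) x)
    (hWderiv : ∀ x ∈ Set.Ici (0 : ℝ), HasDerivWithinAt W (Wd x) (Set.Ici 0) x)
    (f fd g gd : ℂ → ℝ → ℂ)
    (hf : ∀ k : ℂ, IsJostSolution V xI k (f k) (fd k))
    (hg : ∀ k : ℂ, IsJostSolution W xI k (g k) (gd k))
    (hM : ∀ k : ℂ, 0 < k.im → jostFn h f fd k * jostFn h g gd k ≠ 0 →
      f k 0 / jostFn h f fd k = g k 0 / jostFn h g gd k) :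
    ∀ᵐ x ∂(volume.restrict (Set.Ici (0 : ℝ))), V x = W x := by
  have hbdd : ∀ {Q Qd : ℝ → ℝ},
      (∀ x ∈ Set.Ici (0 : ℝ), HasDerivWithinAt Q (Qd x) (Set.Ici 0) x) →
      ∃ B, ∀ x ∈ Icc 0 xI, |Q x| ≤ B := fun hQ =>
    isCompact_Icc.exists_bound_of_continuousOn
      fun x hx => (hQ x hx.1).continuousWithinAt.mono Icc_subset_Ici_self
  obtain ⟨B₁, hB₁'⟩ := hbdd hVderiv
  obtain ⟨B₂, hB₂'⟩ := hbdd hWderiv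
  set B := max B₁ B₂
  have hB₁ : ∀ x ∈ Icc 0 xI, |V x| ≤ B := fun x hx => (hB₁' x hx).trans (le_max_left _ _)
  have hB₂ : ∀ x ∈ Icc 0 xI, |W x| ≤ B := fun x hx => (hB₂' x hx).trans (le_max_right _ _)
  have hB0 : 0 ≤ B * xI := mul_nonneg ((abs_nonneg _).trans (hB₁ 0 ⟨le_rfl, hxI.le⟩)) hxI.le
  obtain ⟨φ₁, φ₁', θ₁, θ₁', hs₁, hφ₁, hθ₁, hdec₁⟩ := exists_isFundamentalSystem h hxI.le hf
  obtain ⟨φ₂, φ₂', θ₂, θ₂', hs₂, hφ₂, hθ₂, hdec₂⟩ := exists_isFundamentalSystem h hxI.le hg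
  have hcross : ∀ x ∈ Icc 0 xI, ∀ k ≠ 0, φ₁ k x * θ₂ k x - φ₂ k x * θ₁ k x = 0 := by
    intro x hx k hk
    refine eq_zero_of_even_of_decay (F := fun k => φ₁ k x * θ₂ k x - φ₂ k x * θ₁ k x)
      (R := 8 * (B * xI) + 8 * |h| + 1) (C := 16 * (2 * (1 + |h|)))
      (fun l hl => ?_) (fun R => ?_) (fun l _ => ?_) (fun l hl hlR => ?_) hk
    · exact ((hs₁.differentiableAt_left hB₁ hl hx).fun_mul
        (hs₂.differentiableAt_right hB₂ hl hx)).fun_sub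
        ((hs₂.differentiableAt_left hB₂ hl hx).fun_mul (hs₁.differentiableAt_right hB₁ hl hx))
    · obtain ⟨C₁, hC₁⟩ := hs₁.exists_bound hB₁ R
      obtain ⟨C₂, hC₂⟩ := hs₂.exists_bound hB₂ R
      refine ⟨C₁ * C₂ + C₂ * C₁, fun l hl hlR => ?_⟩
      obtain ⟨b₁, b₂⟩ := hC₁ l hl hlR x hx
      obtain ⟨b₃, b₄⟩ := hC₂ l hl hlR x hx
      refine (norm_sub_le _ _).trans ?_
      rw [norm_mul, norm_mul]
      exact add_le_add
        (mul_le_mul b₁ b₄ (norm_nonneg _) ((norm_nonneg _).trans b₁))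
        (mul_le_mul b₃ b₂ (norm_nonneg _) ((norm_nonneg _).trans b₃))
    · simp only [hφ₁, hφ₂, hθ₁, hθ₂]
    · have hl0 : l ≠ 0 := fun h0 => by simp [h0] at hl
      have hh := abs_nonneg h
      have hl1 : 1 ≤ ‖l‖ := by linarith
      have hl2 : 2 * (B * xI) ≤ ‖l‖ := by linarith
      have hl3 : 8 * (B * xI) + 8 * |h| ≤ ‖l‖ := by linarith
      have hfx := (hf l).norm_le_exp_neg hxI.le hB₁ hl0 hl.le hl2 hx
      have hgx := (hg l).norm_le_exp_neg hxI.le hB₂ hl0 hl.le hl2 hx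
      rw [Real.exp_neg] at hfx hgx
      exact norm_cross_le (Real.exp_pos (l.im * x)) (norm_pos_iff.2 hl0)
        (hdec₁ l hl0 x) (hdec₂ l hl0 x)
        (half_norm_le_norm_jostFn (hf l) hxI.le hB₁ hl0 hl.le hl3)
        (half_norm_le_norm_jostFn (hg l) hxI.le hB₂ hl0 hl.le hl3) (hM l hl)
        (hs₁.norm_left_le hB₁ hl.le hl1 hl2 hx) (hs₂.norm_left_le hB₂ hl.le hl1 hl2 hx) hfx hgx
  have h1 : (1 : ℂ) ≠ 0 := one_ne_zero
  have hφsq : ∀ x ∈ Icc 0 xI, φ₁ 1 x ^ 2 = φ₂ 1 x ^ 2 := fun x hx =>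
    (hs₁.left 1 h1).sq_eq_sq (hs₁.right 1 h1) (hs₂.left 1 h1) (hs₂.right 1 h1) hxI h1
      (fun y hy => hs₁.wronskian h1 hy) (fun y hy => hs₂.wronskian h1 hy)
      (fun y hy => sub_eq_zero.1 (hcross y hy 1 h1)) hx
  have hθsq : ∀ x ∈ Icc 0 xI, θ₁ 1 x ^ 2 = θ₂ 1 x ^ 2 := fun x hx =>
    (hs₁.right 1 h1).sq_eq_sq (hs₁.left 1 h1) (hs₂.right 1 h1) (hs₂.left 1 h1) hxI
      (neg_ne_zero.2 h1)
      (fun y hy => by linear_combination -hs₁.wronskian h1 hy)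
      (fun y hy => by linear_combination -hs₂.wronskian h1 hy)
      (fun y hy => by linear_combination -hcross y hy 1 h1) hx
  refine (ae_restrict_iff' measurableSet_Ici).2 (Eventually.of_forall fun x hx => ?_)
  by_cases hxx : x ∈ Icc 0 xI
  · by_cases hφ : φ₁ 1 x = 0
    · refine (hs₁.right 1 h1).potential_eq_of_sq_eq_sq (hs₂.right 1 h1) hxI hθsq hxx fun hθ => ?_
      have := hs₁.wronskian h1 hxx
      simp [hφ, hθ] at this
    · exact (hs₁.left 1 h1).potential_eq_of_sq_eq_sq (hs₂.left 1 h1) hxI hφsq hxx hφ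
  · rw [Function.notMem_support.1 fun hv => hxx (hsuppV hv),
      Function.notMem_support.1 fun hw => hxx (hsuppW hw)]
end
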